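/- There exists P such that for every prime p ≥ P the following holds. Let T = φ(p-1) - 1. If T is a prime number and 2 is a primitive root modulo T (i.e., 2 has multiplicative order T-1 modulo T), then the linear complexity of the sequence (s_n) satisfies L(s_n) = T if p ≡ 1 (mod 4), and L(s_n) ≥ T - 1 if p ≡ 3 (mod 4). -/

import Mathlib

open Polynomial

/-- The primitive roots modulo `p` in increasing order: `g_1 < g_2 < … < g_{φ(p-1)}`
(0-indexed as a sorted list). -/
noncomputable def primRootsList (p : ℕ) : List ℕ :=
  ((Finset.Ico 1 p).filter fun g : ℕ => orderOf ((g : ZMod p)) = p - 1).sort (· ≤ ·)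

/-- The binary sequence `s_n ≡ g_{n+1} + g_{n+2} (mod 2)` of period `T = φ(p-1) - 1`,
extended `T`-periodically. -/
noncomputable def seqS (p n : ℕ) : ℕ :=
  ((primRootsList p).getD (n % (Nat.totient (p - 1) - 1)) 0 +
    (primRootsList p).getD (n % (Nat.totient (p - 1) - 1) + 1) 0) % 2

/-- `S(X) = Σ_{n=0}^{T-1} s_n X^n ∈ F_2[X]`. -/
noncomputable def Spoly (p : ℕ) : Polynomial (ZMod 2) :=
  ∑ n ∈ Finset.range (Nat.totient (p - 1) - 1), Polynomial.C ((seqS p n : ZMod 2)) * X ^ n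

/-- The linear complexity `L(s_n) = T - deg(gcd(X^T - 1, S(X)))` of the `T`-periodic
sequence `(s_n)`, `T = φ(p-1) - 1`. -/
noncomputable def linComp (p : ℕ) : ℕ :=
  (Nat.totient (p - 1) - 1) -
    (EuclideanDomain.gcd ((X : Polynomial (ZMod 2)) ^ (Nat.totient (p - 1) - 1) - 1)
      (Spoly p)).natDegree

theorem irreducible_cyclotomic_two {T : ℕ} [Fact T.Prime] (hT : T ≠ 2)
    (h2 : orderOf (2 : ZMod T) = T - 1) : Irreducible (cyclotomic T (ZMod 2)) := by
  have hT' : ¬ 2 ∣ T := fun h =>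
    hT ((Nat.prime_dvd_prime_iff_eq Nat.prime_two Fact.out).1 h).symm
  refine ZMod.irreducible_of_dvd_cyclotomic_of_natDegree hT' dvd_rfl ?_
  rw [natDegree_cyclotomic, Nat.totient_prime Fact.out, ← h2, ← orderOf_units]
  simp

theorem gcd_dvd_X_sub_one {T : ℕ} [Fact T.Prime] (hT : T ≠ 2)
    (h2 : orderOf (2 : ZMod T) = T - 1) {S : (ZMod 2)[X]} (hdeg : S.natDegree < T)
    (h0 : S ≠ 0) (h1 : S ≠ ∑ i ∈ Finset.range T, X ^ i) :
    EuclideanDomain.gcd (X ^ T - 1) S ∣ X - 1 := by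
  have hirr := irreducible_cyclotomic_two hT h2
  have hndvd : ¬ cyclotomic T (ZMod 2) ∣ EuclideanDomain.gcd (X ^ T - 1) S := by
    intro h
    have hass := associated_of_dvd_of_natDegree_le
      (h.trans (EuclideanDomain.gcd_dvd_right _ _)) h0 (by
        rw [natDegree_cyclotomic, Nat.totient_prime Fact.out]; omega)
    have hmon : S.Monic := by
      have hlc : S.leadingCoeff ≠ 0 := leadingCoeff_ne_zero.2 h0
      have hZ : ∀ a : ZMod 2, a ≠ 0 → a = 1 := by decide
      exact hZ _ hlc
    exact h1 ((eq_of_monic_of_associated (cyclotomic.monic T _) hmon hass).symm.trans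
      (cyclotomic_prime _ T))
  have hdvd : EuclideanDomain.gcd (X ^ T - 1) S ∣ cyclotomic T (ZMod 2) * (X - 1) := by
    rw [cyclotomic_prime_mul_X_sub_one]
    exact EuclideanDomain.gcd_dvd_left _ _
  exact ((hirr.coprime_iff_not_dvd.2 hndvd).symm).dvd_of_dvd_mul_left hdvd

theorem natDegree_le_one_of_dvd_X_sub_one {g : (ZMod 2)[X]} (hg : g ∣ X - 1) :
    g.natDegree ≤ 1 :=
  (natDegree_le_of_dvd hg (X_sub_C_ne_zero 1)).trans (natDegree_X_sub_C 1).le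

theorem natDegree_gcd_eq_zero {Q S : (ZMod 2)[X]}
    (hg : EuclideanDomain.gcd Q S ∣ X - 1) (hS : S.eval 1 ≠ 0) :
    (EuclideanDomain.gcd Q S).natDegree = 0 := by
  have hirr : Irreducible (X - C 1 : (ZMod 2)[X]) := irreducible_X_sub_C 1
  rw [← map_one C] at hg
  rcases hirr.dvd_iff.1 hg with h | h
  · exact natDegree_eq_zero_of_isUnit h
  · exact absurd (dvd_iff_isRoot.1 (h.dvd.trans (EuclideanDomain.gcd_dvd_right Q S))) hS

theorem Spoly_coeff (p : ℕ) {n : ℕ} (hn : n < Nat.totient (p - 1) - 1) :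
    (Spoly p).coeff n = seqS p n := by
  simp [Spoly, coeff_X_pow, hn]

theorem natDegree_Spoly_lt (p : ℕ) (h : 0 < Nat.totient (p - 1) - 1) :
    (Spoly p).natDegree < Nat.totient (p - 1) - 1 := by
  rw [Nat.lt_iff_le_pred h]
  refine natDegree_sum_le_of_forall_le _ _ fun i hi => ?_
  exact (natDegree_C_mul_X_pow_le _ _).trans (Nat.le_pred_of_lt (Finset.mem_range.1 hi))

theorem seqS_lt_two (p n : ℕ) : seqS p n < 2 := Nat.mod_lt _ two_pos

theorem seqS_eq_zero_of_Spoly_eq_zero {p : ℕ} (h : Spoly p = 0) {n : ℕ}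
    (hn : n < Nat.totient (p - 1) - 1) : seqS p n = 0 := by
  have := Spoly_coeff p hn
  rw [h, coeff_zero, eq_comm, ZMod.natCast_eq_zero_iff] at this
  exact Nat.eq_zero_of_dvd_of_lt this (seqS_lt_two p n)

theorem seqS_eq_one_of_Spoly_eq_sum {p : ℕ}
    (h : Spoly p = ∑ i ∈ Finset.range (Nat.totient (p - 1) - 1), X ^ i) {n : ℕ}
    (hn : n < Nat.totient (p - 1) - 1) : seqS p n = 1 := by
  have := Spoly_coeff p hn
  have h2 : (1 : ZMod 2) = seqS p n := by
    rw [← this, h]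
    simp [coeff_X_pow, hn]
  have h3 := seqS_lt_two p n
  interval_cases hs : seqS p n
  · simp at h2
  · rfl

theorem mem_primRootsList {p g : ℕ} :
    g ∈ primRootsList p ↔ (1 ≤ g ∧ g < p) ∧ orderOf (g : ZMod p) = p - 1 := by
  simp [primRootsList]

theorem isChain_primRootsList {p r : ℕ}
    (hlen : (primRootsList p).length = Nat.totient (p - 1))
    (h : ∀ n < Nat.totient (p - 1) - 1, seqS p n = r) :
    (primRootsList p).IsChain fun a b => (a + b) % 2 = r := by
  rw [List.isChain_iff_getElem]
  intro i hi
  rw [← h i (by omega), seqS, Nat.mod_eq_of_lt (by omega : i < Nat.totient (p - 1) - 1),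
    List.getD_eq_getElem _ _ hi, List.getD_eq_getElem _ _ (by omega)]

theorem parity_eq_of_isChain : ∀ {l : List ℕ}, (l.IsChain fun a b => (a + b) % 2 = 0) →
    ∀ a ∈ l, ∀ b ∈ l, a % 2 = b % 2 := by
  intro l h
  have h' : l.IsChain fun a b => a % 2 = b % 2 := h.imp fun a b hab => by omega
  have : IsTrans ℕ fun a b => a % 2 = b % 2 := ⟨fun _ _ _ => Eq.trans⟩
  have : Std.Symm fun a b : ℕ => a % 2 = b % 2 := ⟨fun _ _ => Eq.symm⟩
  intro a ha b hb
  exact List.Pairwise.forall_of_forall (R := fun a b : ℕ => a % 2 = b % 2) (fun _ _ => rfl)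
    (List.isChain_iff_pairwise.1 h') ha hb

theorem sum_filter_neg_one_pow : ∀ {l : List ℕ} (_ : l.SortedLT)
    (_ : l.IsChain fun a b => (a + b) % 2 = 1) (x : ℕ),
    ((l.filter (· < x)).map fun g => (-1 : ℤ) ^ g).sum = 0 ∨
    ((l.filter (· < x)).map fun g => (-1 : ℤ) ^ g).sum = (-1) ^ l.headD 0 := by
  intro l hl
  rw [List.sortedLT_iff_pairwise] at hl
  induction l with
  | nil => simp
  | cons g l ih =>
    intro hc x
    rw [List.pairwise_cons] at hl
    by_cases hx : g < x
    · rw [List.filter_cons_of_pos (by simpa using hx)]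
      rw [List.map_cons, List.sum_cons]
      have ih' := ih hl.2 hc.tail x
      cases l with
      | nil => simp
      | cons g' l =>
        have hpar : (-1 : ℤ) ^ g' = - (-1) ^ g := by
          have h1 := (List.isChain_cons_cons.1 hc).1
          have : Odd (g + g') := Nat.odd_iff.2 h1
          have h2 : (-1 : ℤ) ^ (g + g') = -1 := this.neg_one_pow
          rcases neg_one_pow_eq_or ℤ g with h | h <;> rw [pow_add, h] at h2 <;> rw [h] <;> linarith
        rw [List.headD_cons, hpar] at ih'
        rw [List.headD_cons]
        rcases ih' with h | h <;> rw [h] <;> simp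
    · left
      have : (g :: l).filter (· < x) = [] := by
        rw [List.filter_eq_nil_iff]
        intro a ha
        rcases List.mem_cons.1 ha with rfl | ha
        · simpa using hx
        · have := hl.1 a ha
          simp; omega
      simp [this]

/-- `f : ZMod p → ℂ` is a linear combination of Dirichlet characters modulo `p` whose coefficients
have absolute values summing to at most `B`. -/
def HasCharBound (p : ℕ) [NeZero p] (f : ZMod p → ℂ) (B : ℝ) : Prop :=
  ∃ c : DirichletCharacter ℂ p → ℂ, (∀ x, f x = ∑ χ, c χ * χ x) ∧ ∑ χ, ‖c χ‖ ≤ B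

section HasCharBound

variable {p : ℕ} [Fact p.Prime]

theorem HasCharBound.sub {f g : ZMod p → ℂ} {A B : ℝ} (hf : HasCharBound p f A)
    (hg : HasCharBound p g B) : HasCharBound p (fun x => f x - g x) (A + B) := by
  obtain ⟨a, ha, hA⟩ := hf
  obtain ⟨b, hb, hB⟩ := hg
  refine ⟨fun χ => a χ - b χ, fun x => ?_, ?_⟩
  · simp only [ha, hb, sub_mul, Finset.sum_sub_distrib]
  · refine (Finset.sum_le_sum fun χ _ => norm_sub_le (a χ) (b χ)).trans ?_
    rw [Finset.sum_add_distrib]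
    exact add_le_add hA hB

theorem HasCharBound.mul {f g : ZMod p → ℂ} {A B : ℝ} (hf : HasCharBound p f A)
    (hg : HasCharBound p g B) : HasCharBound p (fun x => f x * g x) (A * B) := by
  obtain ⟨a, ha, hA⟩ := hf
  obtain ⟨b, hb, hB⟩ := hg
  refine ⟨fun χ => ∑ ψ, a ψ * b (ψ⁻¹ * χ), fun x => ?_, ?_⟩
  · beta_reduce
    rw [ha, hb, Finset.sum_mul_sum]
    simp only [Finset.sum_mul]
    conv_rhs => rw [Finset.sum_comm]
    refine Finset.sum_congr rfl fun ψ _ => ?_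
    refine Fintype.sum_equiv (Equiv.mulLeft ψ) _ _ fun χ => ?_
    simp only [Equiv.coe_mulLeft, inv_mul_cancel_left, MulChar.mul_apply]
    ring
  · calc ∑ χ, ‖∑ ψ, a ψ * b (ψ⁻¹ * χ)‖
        ≤ ∑ χ, ∑ ψ, ‖a ψ‖ * ‖b (ψ⁻¹ * χ)‖ := by
          refine Finset.sum_le_sum fun χ _ => (norm_sum_le _ _).trans_eq ?_
          simp only [norm_mul]
      _ = (∑ ψ, ‖a ψ‖) * ∑ χ, ‖b χ‖ := by
          rw [Finset.sum_comm, Finset.sum_mul]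
          refine Finset.sum_congr rfl fun ψ _ => ?_
          rw [← Finset.mul_sum]
          exact congrArg _ (Equiv.sum_comp (Equiv.mulLeft ψ⁻¹) fun χ => ‖b χ‖)
      _ ≤ A * B := mul_le_mul hA hB (Finset.sum_nonneg fun _ _ => norm_nonneg _)
          ((Finset.sum_nonneg fun _ _ => norm_nonneg _).trans hA)

theorem sum_apply_powEqOne_nonneg {m : ℕ} (hm : m ≠ 0) (χ : DirichletCharacter ℂ p) :
    ∃ r : ℝ, 0 ≤ r ∧ ∑ a : ZMod p with a ^ m = 1, χ a⁻¹ = r := by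
  have hne : ∀ a : ZMod p, a ^ m = 1 → a ≠ 0 := by
    rintro a ha rfl
    rw [zero_pow hm] at ha
    exact zero_ne_one ha
  by_cases h : ∃ a : ZMod p, a ^ m = 1 ∧ χ a⁻¹ ≠ 1
  · obtain ⟨b, hb, hχ⟩ := h
    refine ⟨0, le_rfl, ?_⟩
    rw [Complex.ofReal_zero]
    refine eq_zero_of_mul_eq_self_left hχ ?_
    rw [Finset.mul_sum]
    refine Finset.sum_bij' (fun a _ => b * a) (fun a _ => b⁻¹ * a) ?_ ?_ ?_ ?_ ?_
    · intro a ha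
      simp_all [mul_pow]
    · intro a ha
      simp_all [mul_pow]
    · intro a _
      exact inv_mul_cancel_left₀ (hne b hb) a
    · intro a _
      exact mul_inv_cancel_left₀ (hne b hb) a
    · intro a _
      rw [mul_inv, map_mul]
  · push Not at h
    refine ⟨((Finset.univ.filter fun a : ZMod p => a ^ m = 1).card : ℝ), Nat.cast_nonneg _, ?_⟩
    rw [Finset.sum_congr rfl fun a ha => h a (Finset.mem_filter.1 ha).2]
    simp

theorem hasCharBound_powEqOne {m : ℕ} (hm : m ≠ 0) :
    HasCharBound p (fun x => if x ^ m = 1 then 1 else 0) 1 := by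
  have hp1 : (0 : ℝ) < (p.totient : ℝ) := by
    exact_mod_cast Nat.totient_pos.2 (Fact.out : p.Prime).pos
  have hp0 : (p.totient : ℂ) ≠ 0 := by exact_mod_cast hp1.ne'
  set c : DirichletCharacter ℂ p → ℂ :=
    fun χ => (p.totient : ℂ)⁻¹ * ∑ a : ZMod p with a ^ m = 1, χ a⁻¹ with hc
  have hexp : ∀ x : ZMod p, (if x ^ m = 1 then 1 else 0 : ℂ) = ∑ χ, c χ * χ x := by
    intro x
    have : ∀ a ∈ Finset.univ.filter (fun a : ZMod p => a ^ m = 1),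
        ∑ χ : DirichletCharacter ℂ p, χ a⁻¹ * χ x = if a = x then (p.totient : ℂ) else 0 := by
      intro a ha
      refine DirichletCharacter.sum_char_inv_mul_char_eq ℂ (isUnit_iff_ne_zero.2 ?_) x
      rintro rfl
      simp [hm] at ha
    simp only [hc, mul_assoc, Finset.sum_mul]
    rw [← Finset.mul_sum, Finset.sum_comm, Finset.sum_congr rfl this, Finset.sum_ite_eq']
    simp [hp0]
  refine ⟨c, hexp, ?_⟩
  have hnorm : ∀ χ, ((‖c χ‖ : ℝ) : ℂ) = c χ := by
    intro χ
    obtain ⟨r, hr, h⟩ := sum_apply_powEqOne_nonneg hm χ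
    simp [hc, h, abs_of_nonneg hr]
  have h1 := hexp 1
  simp only [one_pow, if_true, map_one, mul_one] at h1
  have h2 : ((∑ χ, ‖c χ‖ : ℝ) : ℂ) = 1 := by
    rw [Complex.ofReal_sum, h1]
    exact Finset.sum_congr rfl fun χ _ => hnorm χ
  exact (by exact_mod_cast h2 : ∑ χ, ‖c χ‖ = 1).le

theorem HasCharBound.prod_sub {m : ℕ} (hm : m ≠ 0) (k : ℕ → ℕ) (s : Finset ℕ)
    (hk : ∀ l ∈ s, k l ≠ 0) :
    HasCharBound p (fun x => (if x ^ m = 1 then 1 else 0) *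
      ∏ l ∈ s, ((if x ^ m = 1 then 1 else 0) - if x ^ k l = 1 then 1 else 0)) (2 ^ s.card) := by
  induction s using Finset.induction_on with
  | empty => simpa using hasCharBound_powEqOne hm
  | insert l s hl ih =>
    have h := (ih fun i hi => hk i (Finset.mem_insert_of_mem hi)).mul
      ((hasCharBound_powEqOne (p := p) hm).sub
        (hasCharBound_powEqOne (p := p) (hk l (Finset.mem_insert_self l s))))
    rw [Finset.card_insert_of_notMem hl, pow_succ]
    convert h using 2 with x
    · rw [Finset.prod_insert hl]
      ring
    · norm_num

theorem hasCharBound_orderOf :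
    HasCharBound p (fun x => if orderOf x = p - 1 then 1 else 0)
      (2 ^ (p - 1).primeFactors.card) := by
  have hn : p - 1 ≠ 0 := by have := (Fact.out : p.Prime).two_le; omega
  have h := HasCharBound.prod_sub (p := p) hn (fun l => (p - 1) / l) (p - 1).primeFactors (by
    intro l hl
    exact (Nat.div_pos (Nat.le_of_mem_primeFactors hl) (Nat.pos_of_mem_primeFactors hl)).ne')
  convert h using 2 with x
  by_cases hx : x ^ (p - 1) = 1
  · simp only [hx, if_true, one_mul]
    by_cases hall : ∀ l ∈ (p - 1).primeFactors, x ^ ((p - 1) / l) ≠ 1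
    · rw [if_pos, Finset.prod_eq_one]
      · intro l hl
        simp [hall l hl]
      · exact orderOf_eq_of_pow_and_pow_div_prime (Nat.pos_of_ne_zero hn) hx fun l hl hd =>
          hall l (Nat.mem_primeFactors.2 ⟨hl, hd, hn⟩)
    · push Not at hall
      obtain ⟨l, hl, hxl⟩ := hall
      rw [if_neg, Finset.prod_eq_zero hl]
      · simp [hxl]
      · intro ho
        have h1 := orderOf_dvd_of_pow_eq_one hxl
        rw [ho] at h1
        have h2 := Nat.le_of_dvd (Nat.div_pos (Nat.le_of_mem_primeFactors hl)
          (Nat.pos_of_mem_primeFactors hl)) h1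
        have h3 := Nat.div_lt_self (Nat.pos_of_ne_zero hn)
          (Nat.prime_of_mem_primeFactors hl).one_lt
        omega
  · rw [if_neg, if_neg hx, zero_mul]
    intro ho
    exact hx (ho ▸ pow_orderOf_eq_one x)

theorem norm_jacobiSum_le {χ ψ : DirichletCharacter ℂ p} (h : ¬ (χ = 1 ∧ ψ = 1)) :
    ‖jacobiSum χ ψ‖ ≤ √p := by
  have hp1 : (1 : ℝ) ≤ √p := by
    rw [Real.one_le_sqrt]
    exact_mod_cast (Fact.out : p.Prime).one_le
  by_cases hχ : χ = 1
  · have hψ : ψ ≠ 1 := fun hψ => h ⟨hχ, hψ⟩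
    rw [hχ, jacobiSum_one_nontrivial hψ]
    simpa using hp1
  by_cases hψ : ψ = 1
  · rw [hψ, jacobiSum_comm, jacobiSum_one_nontrivial hχ]
    simpa using hp1
  by_cases hm : χ * ψ = 1
  · rw [eq_inv_of_mul_eq_one_right hm, jacobiSum_nontrivial_inv hχ, norm_neg]
    exact (DirichletCharacter.norm_le_one χ _).trans hp1
  · have hstar : jacobiSum χ⁻¹ ψ⁻¹ = (starRingEnd ℂ) (jacobiSum χ ψ) := by
      simp only [jacobiSum, map_sum, map_mul]
      refine Finset.sum_congr rfl fun x _ => ?_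
      rw [← MulChar.star_eq_inv, ← MulChar.star_eq_inv]
      rfl
    have := jacobiSum_mul_jacobiSum_inv (F' := ℂ) (by
      rw [ringChar.eq_zero, ZMod.ringChar_zmod_n]
      exact (Fact.out : p.Prime).ne_zero.symm) hχ hψ hm
    rw [hstar, Complex.mul_conj, ZMod.card, Complex.normSq_eq_norm_sq] at this
    apply Real.le_sqrt_of_sq_le
    exact (by exact_mod_cast this : ‖jacobiSum χ ψ‖ ^ 2 = p).le

theorem sum_apply_mul_apply_add (χ ψ : DirichletCharacter ℂ p) {h : ZMod p} (hh : h ≠ 0) :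
    ∑ x, χ x * ψ (x + h) = χ (-h) * ψ h * jacobiSum χ ψ := by
  rw [jacobiSum, Finset.mul_sum]
  refine (Fintype.sum_equiv (Equiv.mulLeft₀ (-h) (neg_ne_zero.2 hh)) _ _ fun x => ?_).symm
  rw [Equiv.mulLeft₀_apply, map_mul, show -h * x + h = h * (1 - x) by ring, map_mul]
  ring

theorem norm_sum_apply_mul_apply_add_le {χ ψ : DirichletCharacter ℂ p} {h : ZMod p} (hh : h ≠ 0) :
    ‖(∑ x, χ x * ψ (x + h)) - if χ = 1 ∧ ψ = 1 then (p - 2 : ℂ) else 0‖ ≤ √p := by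
  rw [sum_apply_mul_apply_add χ ψ hh]
  split_ifs with h1
  · rw [h1.1, h1.2, jacobiSum_one_one, MulChar.one_apply (isUnit_iff_ne_zero.2 hh),
      MulChar.one_apply (isUnit_iff_ne_zero.2 (neg_ne_zero.2 hh)), ZMod.card]
    simp
  · rw [sub_zero, norm_mul, norm_mul]
    have h2 : ‖χ (-h)‖ * ‖ψ h‖ ≤ 1 :=
      mul_le_one₀ (DirichletCharacter.norm_le_one _ _) (norm_nonneg _)
        (DirichletCharacter.norm_le_one _ _)
    exact (mul_le_of_le_one_left (norm_nonneg _) h2).trans (norm_jacobiSum_le h1)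

theorem HasCharBound.norm_correlation_le {f : ZMod p → ℂ} {B : ℝ} (hf : HasCharBound p f B)
    {h : ZMod p} (hh : h ≠ 0) :
    ‖(∑ x, f x * f (x + h)) - ((∑ x, f x) / (p - 1)) ^ 2 * (p - 2)‖ ≤ B ^ 2 * √p := by
  obtain ⟨c, hc, hB⟩ := hf
  have hp1 : (p - 1 : ℂ) ≠ 0 := by
    rw [sub_ne_zero]
    exact_mod_cast (Fact.out : p.Prime).one_lt.ne'
  have hmean : (∑ x, f x) / (p - 1) = c 1 := by
    rw [div_eq_iff hp1]
    simp only [hc]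
    rw [Finset.sum_comm, Finset.sum_eq_single 1]
    · rw [← Finset.mul_sum, MulChar.sum_one_eq_card_units, ZMod.card_units,
        Nat.cast_sub (Fact.out : p.Prime).one_le, Nat.cast_one]
    · intro χ _ hχ
      rw [← Finset.mul_sum, MulChar.sum_eq_zero_of_ne_one hχ, mul_zero]
    · simp
  have hexp : ∑ x, f x * f (x + h) = ∑ χ, ∑ ψ, c χ * c ψ * ∑ x, χ x * ψ (x + h) := by
    have hx : ∀ x, f x * f (x + h) = ∑ χ, ∑ ψ, c χ * c ψ * (χ x * ψ (x + h)) := by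
      intro x
      rw [hc, hc, Finset.sum_mul_sum]
      exact Finset.sum_congr rfl fun χ _ => Finset.sum_congr rfl fun ψ _ => by ring
    simp only [hx, Finset.mul_sum]
    rw [Finset.sum_comm]
    refine Finset.sum_congr rfl fun χ _ => ?_
    exact Finset.sum_comm
  have hmain : (c 1) ^ 2 * (p - 2) =
      ∑ χ, ∑ ψ, c χ * c ψ * if χ = 1 ∧ ψ = 1 then (p - 2 : ℂ) else 0 := by
    simp [ite_and, Finset.sum_ite_eq', sq]
  rw [hmean, hexp, hmain, ← Finset.sum_sub_distrib]
  simp only [← Finset.sum_sub_distrib, ← mul_sub]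
  calc _ ≤ ∑ χ, ∑ ψ, ‖c χ‖ * ‖c ψ‖ * √p := by
        refine (norm_sum_le _ _).trans (Finset.sum_le_sum fun χ _ => ?_)
        refine (norm_sum_le _ _).trans (Finset.sum_le_sum fun ψ _ => ?_)
        rw [norm_mul, norm_mul]
        exact mul_le_mul_of_nonneg_left (norm_sum_apply_mul_apply_add_le hh) (by positivity)
    _ = (∑ χ, ‖c χ‖) ^ 2 * √p := by
        rw [sq, Finset.sum_mul_sum, Finset.sum_mul]
        simp only [Finset.sum_mul]
    _ ≤ B ^ 2 * √p := by
        have : 0 ≤ ∑ χ, ‖c χ‖ := Finset.sum_nonneg fun _ _ => norm_nonneg _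
        gcongr

end HasCharBound

theorem prod_primeFactors_sub_one_dvd_totient (n : ℕ) :
    ∏ l ∈ n.primeFactors, (l - 1) ∣ n.totient :=
  (Nat.totient_eq_div_primeFactors_mul n).symm ▸ Dvd.intro_left _ rfl

theorem two_pow_dvd_totient (n : ℕ) : 2 ^ (n.primeFactors.card - 1) ∣ n.totient := by
  refine dvd_trans ?_ (prod_primeFactors_sub_one_dvd_totient n)
  calc 2 ^ (n.primeFactors.card - 1) ∣ 2 ^ (n.primeFactors.erase 2).card :=
        pow_dvd_pow 2 Finset.pred_card_le_card_erase
    _ ∣ ∏ l ∈ n.primeFactors.erase 2, (l - 1) := by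
        rw [← Finset.prod_const]
        refine Finset.prod_dvd_prod_of_dvd _ _ fun l hl => ?_
        rw [Finset.mem_erase] at hl
        have := (Nat.prime_of_mem_primeFactors hl.2).odd_of_ne_two hl.1
        exact (Nat.Odd.sub_odd this odd_one).two_dvd
    _ ∣ _ := Finset.prod_dvd_prod_of_subset _ _ _ (Finset.erase_subset _ _)

theorem le_two_pow_mul_totient (n : ℕ) : n ≤ 2 ^ n.primeFactors.card * n.totient := by
  have hpos : 0 < ∏ l ∈ n.primeFactors, (l - 1) :=
    Finset.prod_pos fun l hl => Nat.sub_pos_of_lt (Nat.prime_of_mem_primeFactors hl).one_lt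
  refine Nat.le_of_mul_le_mul_right ?_ hpos
  rw [← Nat.totient_mul_prod_primeFactors, mul_comm (2 ^ _), mul_assoc]
  refine Nat.mul_le_mul_left _ ?_
  rw [← Finset.prod_const, ← Finset.prod_mul_distrib]
  refine Finset.prod_le_prod' fun l hl => ?_
  have := (Nat.prime_of_mem_primeFactors hl).two_le
  omega

theorem two_mul_totient_le {n : ℕ} (hn : 2 ∣ n) : 2 * n.totient ≤ n := by
  rcases Nat.eq_zero_or_pos n with rfl | hpos
  · simp
  have h2 : 2 ∈ n.primeFactors := Nat.mem_primeFactors.2 ⟨Nat.prime_two, hn, hpos.ne'⟩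
  have hprod : 0 < ∏ l ∈ n.primeFactors.erase 2, l :=
    Finset.prod_pos fun l hl => Nat.pos_of_mem_primeFactors (Finset.mem_of_mem_erase hl)
  refine Nat.le_of_mul_le_mul_right ?_ hprod
  have h := Nat.totient_mul_prod_primeFactors n
  rw [← Finset.mul_prod_erase _ _ h2, ← Finset.mul_prod_erase _ _ h2, Nat.add_one_sub_one,
    one_mul] at h
  calc 2 * n.totient * ∏ l ∈ n.primeFactors.erase 2, l
      = n * ∏ l ∈ n.primeFactors.erase 2, (l - 1) := by rw [← h]; ring
    _ ≤ n * ∏ l ∈ n.primeFactors.erase 2, l :=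
        Nat.mul_le_mul_left _ (Finset.prod_le_prod' fun l _ => Nat.sub_le l 1)

theorem not_eight_dvd_add_one_of_orderOf_two {T : ℕ} [Fact T.Prime] (hT : 3 < T)
    (h2 : orderOf (2 : ZMod T) = T - 1) : ¬ 8 ∣ T + 1 := by
  intro h
  obtain ⟨y, hy⟩ := (ZMod.exists_sq_eq_two_iff (p := T) (by omega)).2 (Or.inr (by omega))
  have hy0 : y ≠ 0 := by
    rintro rfl
    rw [mul_zero] at hy
    rw [hy, orderOf_zero] at h2
    omega
  have h3 : (2 : ZMod T) ^ ((T - 1) / 2) = 1 := by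
    rw [hy, ← sq, ← pow_mul, show 2 * ((T - 1) / 2) = T - 1 by omega]
    exact ZMod.pow_card_sub_one_eq_one hy0
  have h4 := Nat.le_of_dvd (by omega) (orderOf_dvd_of_pow_eq_one h3)
  omega

section PrimitiveRoots

/-- The real-valued indicator function of the primitive roots modulo `p`. -/
noncomputable def primRootIndicator (p : ℕ) (x : ZMod p) : ℝ :=
  if orderOf x = p - 1 then 1 else 0

/-- The alternating sum of the indicator function of the primitive roots over the window
`x, x + 1, …, x + 15`. -/
noncomputable def windowSum (p : ℕ) (x : ZMod p) : ℝ :=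
  ∑ i ∈ Finset.range 16, (-1) ^ i * primRootIndicator p (x + i)

theorem abs_windowSum_le {p : ℕ} (x : ZMod p) : |windowSum p x| ≤ 16 := by
  refine (Finset.abs_sum_le_sum_abs _ _).trans ?_
  calc _ ≤ ∑ _i ∈ Finset.range 16, (1 : ℝ) := by
        refine Finset.sum_le_sum fun i _ => ?_
        rw [abs_mul, abs_pow, abs_neg, abs_one, one_pow, one_mul, primRootIndicator]
        split_ifs <;> simp
    _ = 16 := by simp

variable {p : ℕ} [Fact p.Prime]

theorem card_orderOf_eq_sub_one :
    (Finset.univ.filter fun x : ZMod p => orderOf x = p - 1).card = (p - 1).totient := by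
  have h := IsCyclic.card_orderOf_eq_totient (α := (ZMod p)ˣ) (d := p - 1)
    (by rw [ZMod.card_units])
  rw [← h]
  symm
  refine Finset.card_bij (fun u _ => (u : ZMod p)) ?_ (fun _ _ _ _ => Units.ext) ?_
  · intro u hu
    simpa [orderOf_units] using hu
  · intro x hx
    have hx' : orderOf x = p - 1 := by simpa using hx
    have hx0 : x ≠ 0 := by
      rintro rfl
      have := (Fact.out : p.Prime).two_le
      rw [orderOf_zero] at hx'
      omega
    exact ⟨Units.mk0 x hx0, by simpa [← orderOf_units] using hx', rfl⟩

theorem orderOf_natCast_iff_mem {n : ℕ} (hn : n < p) :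
    orderOf (n : ZMod p) = p - 1 ↔ n ∈ primRootsList p := by
  rw [mem_primRootsList]
  refine ⟨fun h => ⟨⟨Nat.one_le_iff_ne_zero.2 ?_, hn⟩, h⟩, And.right⟩
  rintro rfl
  have := (Fact.out : p.Prime).two_le
  rw [Nat.cast_zero, orderOf_zero] at h
  omega

theorem length_primRootsList : (primRootsList p).length = (p - 1).totient := by
  rw [primRootsList, Finset.length_sort, ← card_orderOf_eq_sub_one (p := p)]
  refine Finset.card_bij (fun g _ => (g : ZMod p)) ?_ ?_ ?_
  · intro g hg
    simpa using (Finset.mem_filter.1 hg).2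
  · intro a ha b hb hab
    simp only [Finset.mem_filter, Finset.mem_Ico] at ha hb
    have := congrArg ZMod.val hab
    rwa [ZMod.val_natCast_of_lt ha.1.2, ZMod.val_natCast_of_lt hb.1.2] at this
  · intro x hx
    have h := (orderOf_natCast_iff_mem (ZMod.val_lt x)).1
      (by rw [ZMod.natCast_zmod_val]; exact (Finset.mem_filter.1 hx).2)
    rw [mem_primRootsList] at h
    exact ⟨x.val, by simpa using h, ZMod.natCast_zmod_val x⟩

theorem sortedLT_primRootsList (p : ℕ) : (primRootsList p).SortedLT :=
  Finset.sortedLT_sort _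

theorem sum_primRootIndicator : ∑ x, primRootIndicator p x = (p - 1).totient := by
  simp [primRootIndicator, Finset.sum_boole, card_orderOf_eq_sub_one]

theorem abs_correlation_primRootIndicator_le {h : ZMod p} (hh : h ≠ 0) :
    |(∑ x, primRootIndicator p x * primRootIndicator p (x + h)) -
      ((p - 1).totient / (p - 1) : ℝ) ^ 2 * (p - 2)| ≤
      (2 ^ (p - 1).primeFactors.card) ^ 2 * √p := by
  have hb : HasCharBound p (fun x => (primRootIndicator p x : ℂ))
      (2 ^ (p - 1).primeFactors.card) := by
    convert hasCharBound_orderOf (p := p) using 2 with x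
    simp only [primRootIndicator]
    split_ifs <;> simp
  have := hb.norm_correlation_le hh
  rw [← Complex.ofReal_sum, sum_primRootIndicator] at this
  rw [← Real.norm_eq_abs, ← Complex.norm_real]
  convert this using 2
  push_cast
  rfl

theorem le_sum_windowSum_sq {M E : ℝ} (hp : 16 ≤ p) (hE : 0 ≤ E)
    (hcorr : ∀ h : ZMod p, h ≠ 0 →
      |(∑ x, primRootIndicator p x * primRootIndicator p (x + h)) - M| ≤ E) :
    16 * ((p - 1).totient - M) - 256 * E ≤ ∑ x, windowSum p x ^ 2 := by
  have hexp : ∑ x, windowSum p x ^ 2 = ∑ i ∈ Finset.range 16, ∑ j ∈ Finset.range 16,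
      (-1 : ℝ) ^ i * (-1) ^ j *
        ∑ x, primRootIndicator p (x + i) * primRootIndicator p (x + j) := by
    have hx : ∀ x, windowSum p x ^ 2 = ∑ i ∈ Finset.range 16, ∑ j ∈ Finset.range 16,
        (-1 : ℝ) ^ i * (-1) ^ j * (primRootIndicator p (x + i) * primRootIndicator p (x + j)) := by
      intro x
      rw [windowSum, sq, Finset.sum_mul_sum]
      exact Finset.sum_congr rfl fun i _ => Finset.sum_congr rfl fun j _ => by ring
    simp only [hx, Finset.mul_sum]
    rw [Finset.sum_comm]
    exact Finset.sum_congr rfl fun i _ => Finset.sum_comm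
  have hterm : ∀ i ∈ Finset.range 16, ∀ j ∈ Finset.range 16,
      (-1 : ℝ) ^ i * (-1) ^ j * M - E + (if i = j then ((p - 1).totient - M : ℝ) else 0) ≤
        (-1 : ℝ) ^ i * (-1) ^ j *
          ∑ x, primRootIndicator p (x + i) * primRootIndicator p (x + j) := by
    intro i hi j hj
    rw [Finset.mem_range] at hi hj
    have hshift : ∑ x, primRootIndicator p (x + i) * primRootIndicator p (x + j) =
        ∑ x, primRootIndicator p x * primRootIndicator p (x + (j - i : ZMod p)) := by
      refine Fintype.sum_equiv (Equiv.addRight (i : ZMod p)) _ _ fun x => ?_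
      rw [Equiv.coe_addRight, show x + i + ((j : ZMod p) - i) = x + j by ring]
    rw [hshift]
    by_cases hij : i = j
    · subst hij
      have : ∑ x, primRootIndicator p x * primRootIndicator p (x + ((i : ZMod p) - i)) =
          (p - 1).totient := by
        rw [← sum_primRootIndicator]
        refine Finset.sum_congr rfl fun x _ => ?_
        simp [primRootIndicator]
      rw [this, if_pos rfl, ← mul_pow]
      norm_num
      linarith
    · have hne : (j - i : ZMod p) ≠ 0 := by
        rw [sub_ne_zero]
        intro h
        have := congrArg ZMod.val h
        rw [ZMod.val_natCast_of_lt (by omega), ZMod.val_natCast_of_lt (by omega)] at this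
        exact hij this.symm
      have := abs_le.1 (hcorr _ hne)
      rw [if_neg hij, ← pow_add]
      rcases neg_one_pow_eq_or ℝ (i + j) with h | h <;> rw [h] <;> linarith
  rw [hexp]
  refine le_trans ?_ (Finset.sum_le_sum fun i hi => Finset.sum_le_sum fun j hj => hterm i hi j hj)
  have halt : ∑ i ∈ Finset.range 16, ∑ j ∈ Finset.range 16, (-1 : ℝ) ^ i * (-1) ^ j * M = 0 := by
    simp only [← Finset.sum_mul, ← Finset.mul_sum]
    norm_num [Finset.sum_range_succ]
  have hdiag : ∑ i ∈ Finset.range 16, ∑ j ∈ Finset.range 16,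
      (if i = j then ((p - 1).totient - M : ℝ) else 0) = 16 * ((p - 1).totient - M) := by
    rw [Finset.sum_congr rfl fun i hi => (Finset.sum_ite_eq _ _ _).trans (if_pos hi)]
    rw [Finset.sum_const, Finset.card_range, nsmul_eq_mul, Nat.cast_ofNat]
  simp only [Finset.sum_add_distrib, Finset.sum_sub_distrib, halt, hdiag]
  simp only [Finset.sum_const, Finset.card_range, nsmul_eq_mul]
  push_cast
  linarith

theorem abs_windowSum_le_one (hc : (primRootsList p).IsChain fun a b => (a + b) % 2 = 1)
    {x : ZMod p} (hx : x.val + 16 ≤ p) : |windowSum p x| ≤ 1 := by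
  set F : ℕ → ℤ := fun n => (((primRootsList p).filter (· < n)).map fun g => (-1 : ℤ) ^ g).sum
    with hF
  have hFsum : ∀ n, F n = ∑ g ∈ Finset.range n, if g ∈ primRootsList p then (-1 : ℤ) ^ g else 0 := by
    intro n
    rw [hF, ← Finset.sum_filter]
    beta_reduce
    rw [← List.sum_toFinset _ ((sortedLT_primRootsList p).nodup.filter _)]
    refine Finset.sum_congr (Finset.ext fun g => ?_) fun _ _ => rfl
    simp [and_comm]
  have hw : windowSum p x = (-1) ^ x.val * ((F (x.val + 16) - F x.val : ℤ) : ℝ) := by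
    rw [hFsum, hFsum, Finset.sum_range_add_sub_sum_range]
    push_cast
    rw [windowSum, Finset.mul_sum]
    refine Finset.sum_congr rfl fun i hi => ?_
    rw [Finset.mem_range] at hi
    have hcast : x + i = ((x.val + i : ℕ) : ZMod p) := by
      rw [Nat.cast_add, ZMod.natCast_zmod_val]
    simp only [primRootIndicator, hcast,
      orderOf_natCast_iff_mem (show x.val + i < p by omega)]
    split_ifs
    · rw [pow_add, ← mul_assoc, ← mul_pow]
      norm_num
    · simp
  have h1 := sum_filter_neg_one_pow (sortedLT_primRootsList p) hc x.val
  have h2 := sum_filter_neg_one_pow (sortedLT_primRootsList p) hc (x.val + 16)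
  rw [hw, abs_mul, abs_pow, abs_neg, abs_one, one_pow, one_mul, ← Int.cast_abs]
  have : |F (x.val + 16) - F x.val| ≤ 1 := by
    rcases neg_one_pow_eq_or ℤ ((primRootsList p).headD 0) with h | h <;> rw [h] at h1 h2 <;>
      rcases h1 with h1 | h1 <;> rcases h2 with h2 | h2 <;> simp [hF, h1, h2]
  exact_mod_cast this

theorem sum_windowSum_sq_le (hc : (primRootsList p).IsChain fun a b => (a + b) % 2 = 1) :
    ∑ x, windowSum p x ^ 2 ≤ p + 4096 := by
  have hterm : ∀ x : ZMod p, windowSum p x ^ 2 ≤ 1 + if p < x.val + 16 then 256 else 0 := by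
    intro x
    split_ifs with hx
    · have := sq_le_sq' (abs_le.1 (abs_windowSum_le x)).1 (abs_le.1 (abs_windowSum_le x)).2
      linarith
    · rw [add_zero, sq_le_one_iff_abs_le_one]
      exact abs_windowSum_le_one hc (by omega)
  have hcard : (Finset.univ.filter fun x : ZMod p => p < x.val + 16).card ≤ 16 := by
    calc _ ≤ (Finset.Ico (p - 16) p).card := by
          refine Finset.card_le_card_of_injOn ZMod.val ?_ (ZMod.val_injective p).injOn
          intro x hx
          have h1 := ZMod.val_lt x
          have h2 : p < x.val + 16 := by simpa using hx
          simp only [Finset.coe_Ico, Set.mem_Ico]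
          omega
      _ ≤ 16 := by rw [Nat.card_Ico]; omega
  refine (Finset.sum_le_sum fun x _ => hterm x).trans ?_
  rw [Finset.sum_add_distrib, ← Finset.sum_filter, Finset.sum_const, Finset.sum_const,
    Finset.card_univ, ZMod.card]
  have : ((Finset.univ.filter fun x : ZMod p => p < x.val + 16).card : ℝ) ≤ 16 := by
    exact_mod_cast hcard
  simp only [nsmul_eq_mul]
  linarith

theorem not_isChain_odd {M E : ℝ} (hp : 16 ≤ p) (hE : 0 ≤ E)
    (hcorr : ∀ h : ZMod p, h ≠ 0 →
      |(∑ x, primRootIndicator p x * primRootIndicator p (x + h)) - M| ≤ E)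
    (hlarge : p + 4096 < 16 * ((p - 1).totient - M) - 256 * E) :
    ¬ (primRootsList p).IsChain fun a b => (a + b) % 2 = 1 := fun hc =>
  absurd ((le_sum_windowSum_sq hp hE hcorr).trans (sum_windowSum_sq_le hc)) hlarge.not_ge

theorem not_isChain_even {M E : ℝ} (hcorr : ∀ h : ZMod p, h ≠ 0 →
      |(∑ x, primRootIndicator p x * primRootIndicator p (x + h)) - M| ≤ E)
    (hlarge : E < M) : ¬ (primRootsList p).IsChain fun a b => (a + b) % 2 = 0 := by
  intro hc
  have h1 := (abs_le.1 (hcorr 1 one_ne_zero)).1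
  obtain ⟨x, -, hx⟩ := Finset.exists_ne_zero_of_sum_ne_zero
    (by linarith : 0 < ∑ x, primRootIndicator p x * primRootIndicator p (x + 1)).ne'
  have hx1 : orderOf x = p - 1 := by
    by_contra h
    simp [primRootIndicator, h] at hx
  have hx2 : orderOf (x + 1) = p - 1 := by
    by_contra h
    simp [primRootIndicator, h] at hx
  have hm1 := (orderOf_natCast_iff_mem (ZMod.val_lt x)).1 (by rwa [ZMod.natCast_zmod_val])
  have hcast : ((x.val + 1 : ℕ) : ZMod p) = x + 1 := by
    rw [Nat.cast_add, ZMod.natCast_zmod_val, Nat.cast_one]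
  have hlt : x.val + 1 < p := by
    refine lt_of_le_of_ne (ZMod.val_lt x) fun h => ?_
    rw [← hcast, h, ZMod.natCast_self, orderOf_zero] at hx2
    have := (Fact.out : p.Prime).two_le
    omega
  have hm2 := (orderOf_natCast_iff_mem hlt).1 (by rwa [hcast])
  have := parity_eq_of_isChain hc _ hm1 _ hm2
  omega

theorem correlation_numerics (hp : 10 ^ 10 ≤ p) (hω : (p - 1).primeFactors.card ≤ 3) :
    let M : ℝ := ((p - 1).totient / (p - 1) : ℝ) ^ 2 * (p - 2)
    let E : ℝ := 64 * √p
    E < M ∧ p + 4096 < 16 * ((p - 1).totient - M) - 256 * E := by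
  intro M E
  have hpR : (10 : ℝ) ^ 10 ≤ p := by exact_mod_cast hp
  have hs : (10 : ℝ) ^ 5 ≤ √p := by
    apply Real.le_sqrt_of_sq_le
    norm_num at hpR ⊢
    exact hpR
  have hsq : √(p : ℝ) ^ 2 = p := Real.sq_sqrt (Nat.cast_nonneg p)
  have hsp : 10 ^ 5 * √(p : ℝ) ≤ p := by nlinarith
  have hcast : ((p - 1 : ℕ) : ℝ) = p - 1 := by
    rw [Nat.cast_sub (by omega), Nat.cast_one]
  have hpos : (0 : ℝ) < p - 1 := by linarith
  have hlow : (p - 1 : ℝ) ≤ 8 * (p - 1).totient := by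
    rw [← hcast]
    have h1 := le_two_pow_mul_totient (p - 1)
    have h2 : 2 ^ (p - 1).primeFactors.card ≤ 2 ^ 3 := Nat.pow_le_pow_right two_pos hω
    exact_mod_cast h1.trans (Nat.mul_le_mul_right _ h2)
  have hup : 2 * ((p - 1).totient : ℝ) ≤ p - 1 := by
    rw [← hcast]
    have hodd := (Fact.out : p.Prime).eq_two_or_odd
    exact_mod_cast two_mul_totient_le (by omega)
  set c : ℝ := (p - 1).totient / (p - 1) with hc
  have hφ : ((p - 1).totient : ℝ) = c * (p - 1) := (div_mul_cancel₀ _ hpos.ne').symm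
  have hc1 : 1 / 8 ≤ c := by rw [hc, le_div_iff₀ hpos]; linarith
  have hc2 : c ≤ 1 / 2 := by rw [hc, div_le_iff₀ hpos]; linarith
  have hcc : 1 / 64 ≤ c ^ 2 := by nlinarith
  constructor
  · have : 1 / 64 * (p - 2 : ℝ) ≤ M := mul_le_mul_of_nonneg_right hcc (by linarith)
    simp only [E]
    linarith
  · have h1 : 7 / 64 ≤ c - c ^ 2 := by nlinarith
    have h2 : 7 / 64 * (p - 1 : ℝ) ≤ (c - c ^ 2) * (p - 1) :=
      mul_le_mul_of_nonneg_right h1 hpos.le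
    have h3 : ((p - 1).totient : ℝ) - M = (c - c ^ 2) * (p - 1) + c ^ 2 := by
      have hM : M = c ^ 2 * (p - 2) := rfl
      rw [hM]
      linear_combination hφ
    rw [h3]
    simp only [E]
    linarith

theorem not_isChain_of_large (hp : 10 ^ 10 ≤ p) (hω : (p - 1).primeFactors.card ≤ 3) {r : ℕ}
    (hr : r < 2) : ¬ (primRootsList p).IsChain fun a b => (a + b) % 2 = r := by
  obtain ⟨h1, h2⟩ := correlation_numerics hp hω
  have hcorr : ∀ h : ZMod p, h ≠ 0 →
      |(∑ x, primRootIndicator p x * primRootIndicator p (x + h)) -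
        ((p - 1).totient / (p - 1) : ℝ) ^ 2 * (p - 2)| ≤ 64 * √p := by
    intro h hh
    refine (abs_correlation_primRootIndicator_le hh).trans ?_
    have : (2 ^ (p - 1).primeFactors.card : ℝ) ≤ 2 ^ 3 := pow_le_pow_right₀ one_le_two hω
    have h64 : (2 ^ (p - 1).primeFactors.card : ℝ) ^ 2 ≤ 64 := by
      calc _ ≤ ((2 : ℝ) ^ 3) ^ 2 := by gcongr
        _ = 64 := by norm_num
    gcongr
  interval_cases r
  · exact not_isChain_even hcorr h1
  · exact not_isChain_odd (by omega) (by positivity) hcorr h2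

theorem sub_mem_primRootsList (hp : p % 4 = 1) {g : ℕ} (hg : g ∈ primRootsList p) :
    p - g ∈ primRootsList p := by
  have hp2 := (Fact.out : p.Prime).two_le
  rw [mem_primRootsList] at hg
  rw [← orderOf_natCast_iff_mem (by omega), Nat.cast_sub hg.1.2.le, ZMod.natCast_self, zero_sub]
  have hg0 : (g : ZMod p) ≠ 0 := by
    intro h
    rw [h, orderOf_zero] at hg
    omega
  refine Nat.dvd_antisymm
    (orderOf_dvd_of_pow_eq_one (ZMod.pow_card_sub_one_eq_one (neg_ne_zero.2 hg0))) ?_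
  have hk := pow_orderOf_eq_one (-(g : ZMod p))
  set k := orderOf (-(g : ZMod p))
  rcases Nat.even_or_odd k with he | ho
  · rw [he.neg_pow] at hk
    exact hg.2 ▸ orderOf_dvd_of_pow_eq_one hk
  · have h2 : (g : ZMod p) ^ (2 * k) = 1 := by
      rw [mul_comm, pow_mul, ← neg_sq, ← ho.neg_pow, hk, one_pow]
    have h3 := orderOf_dvd_of_pow_eq_one h2
    rw [hg.2] at h3
    have h4 : 4 ∣ 2 * k := (by omega : 4 ∣ p - 1).trans h3
    have := Nat.odd_iff.1 ho
    omega

theorem head_add_last_primRootsList (hp : p % 4 = 1)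
    (h : 0 < (primRootsList p).length) :
    (primRootsList p)[0] + (primRootsList p)[(primRootsList p).length - 1] = p := by
  have hmono := (sortedLT_primRootsList p).sortedLE
  have hmin : ∀ a ∈ primRootsList p, (primRootsList p)[0] ≤ a := by
    intro a ha
    obtain ⟨i, hi, rfl⟩ := List.getElem_of_mem ha
    exact hmono.getElem_le_getElem_of_le (Nat.zero_le i)
  have hmax : ∀ a ∈ primRootsList p, a ≤ (primRootsList p)[(primRootsList p).length - 1] := by
    intro a ha
    obtain ⟨i, hi, rfl⟩ := List.getElem_of_mem ha
    exact hmono.getElem_le_getElem_of_le (by omega)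
  have h0 := List.getElem_mem h
  have h1 := List.getElem_mem (l := primRootsList p) (n := (primRootsList p).length - 1) (by omega)
  have h2 := hmax _ (sub_mem_primRootsList hp h0)
  have h3 := hmin _ (sub_mem_primRootsList hp h1)
  have h4 := (mem_primRootsList.1 h0).1
  have h5 := (mem_primRootsList.1 h1).1
  omega

theorem eval_one_Spoly (hp : p % 4 = 1) : (Spoly p).eval 1 = 1 := by
  set T := (p - 1).totient - 1 with hT
  have hlen : (primRootsList p).length = T + 1 := by
    have h1 : 0 < p - 1 := by have := (Fact.out : p.Prime).two_le; omega
    have h2 := Nat.totient_pos.2 h1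
    rw [length_primRootsList]
    omega
  set a : ℕ → ZMod 2 := fun n => (primRootsList p).getD n 0 with ha
  have htel : ∀ k, ∑ n ∈ Finset.range k, (a n + a (n + 1)) = a 0 + a k := by
    intro k
    induction k with
    | zero => rw [Finset.sum_range_zero, CharTwo.add_self_eq_zero]
    | succ k ih =>
      rw [Finset.sum_range_succ, ih, add_assoc, ← add_assoc (a k), CharTwo.add_self_eq_zero,
        zero_add]
  have heval : (Spoly p).eval 1 = ∑ n ∈ Finset.range T, (a n + a (n + 1)) := by
    rw [Spoly, eval_finsetSum]
    refine Finset.sum_congr rfl fun n hn => ?_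
    rw [eval_mul, eval_C, eval_pow, eval_X, one_pow, mul_one, seqS,
      Nat.mod_eq_of_lt (Finset.mem_range.1 hn), ZMod.natCast_mod, Nat.cast_add]
  have hsum := head_add_last_primRootsList hp (by omega)
  rw [heval, htel, ha]
  beta_reduce
  rw [List.getD_eq_getElem _ _ (by omega), List.getD_eq_getElem _ _ (by omega), ← Nat.cast_add]
  simp only [hlen, Nat.add_sub_cancel] at hsum
  rw [hsum, ← ZMod.natCast_mod, (by omega : p % 2 = 1), Nat.cast_one]

end PrimitiveRoots

/-- For all sufficiently large primes `p`: if `T = φ(p-1) - 1` is prime and `2` is a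
primitive root modulo `T`, then `L(s_n) = T` when `p ≡ 1 (mod 4)`, and
`L(s_n) ≥ T - 1` when `p ≡ 3 (mod 4)`. -/
theorem linear_complexity_maximal :
    ∃ P : ℕ, ∀ p : ℕ, Nat.Prime p → P ≤ p →
      (Nat.totient (p - 1) - 1).Prime →
      orderOf ((2 : ZMod (Nat.totient (p - 1) - 1))) = (Nat.totient (p - 1) - 1) - 1 →
      (p % 4 = 1 → linComp p = Nat.totient (p - 1) - 1) ∧
      (p % 4 = 3 → (Nat.totient (p - 1) - 1) - 1 ≤ linComp p) := by
  refine ⟨10 ^ 10, fun p hp hP hT h2 => ?_⟩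
  have : Fact p.Prime := ⟨hp⟩
  have : Fact (Nat.totient (p - 1) - 1).Prime := ⟨hT⟩
  have hpos := hT.pos
  have hT2 : Nat.totient (p - 1) - 1 ≠ 2 := by
    intro h
    rw [h] at h2
    rw [show (2 : ZMod 2) = 0 from rfl, orderOf_zero] at h2
    omega
  have hω : (p - 1).primeFactors.card ≤ 3 := by
    by_contra! hω
    have h8 : 8 ∣ Nat.totient (p - 1) :=
      (pow_dvd_pow 2 (by omega : 3 ≤ (p - 1).primeFactors.card - 1)).trans
        (two_pow_dvd_totient (p - 1))
    exact not_eight_dvd_add_one_of_orderOf_two (by omega) h2 (by omega)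
  have h0 : Spoly p ≠ 0 := fun h =>
    not_isChain_of_large hP hω two_pos
      (isChain_primRootsList length_primRootsList fun n hn => seqS_eq_zero_of_Spoly_eq_zero h hn)
  have h1 : Spoly p ≠ ∑ i ∈ Finset.range (Nat.totient (p - 1) - 1), X ^ i := fun h =>
    not_isChain_of_large hP hω one_lt_two
      (isChain_primRootsList length_primRootsList fun n hn => seqS_eq_one_of_Spoly_eq_sum h hn)
  have hg := gcd_dvd_X_sub_one hT2 h2 (natDegree_Spoly_lt p hpos) h0 h1
  constructor
  · intro h
    have hS : (Spoly p).eval 1 ≠ 0 := by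
      rw [eval_one_Spoly h]
      exact one_ne_zero
    rw [linComp, natDegree_gcd_eq_zero hg hS, Nat.sub_zero]
  · intro _
    have := natDegree_le_one_of_dvd_X_sub_one hg
    rw [linComp]
    omega
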